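/- For ξ = -(1/2)√(1-2c), the third complex derivative of the saddle point function at i equals g_ξ‴(i) = -4c(c+1)/(1-2c)^2 · i. -/

import Mathlib

/-- `c = a/(1+a²)`. -/
noncomputable def cOf (a : ℝ) : ℝ := a / (1 + a ^ 2)

/-- The branch of the logarithm with argument in `(-π/2, 3π/2]`:
`L(z) = Log(-iz) + iπ/2` where `Log` is the principal branch. -/
noncomputable def Lbr (z : ℂ) : ℂ :=
  Complex.log (-Complex.I * z) + Complex.I * ((Real.pi : ℂ) / 2)

/-- The branch `√(ω² + 2c) = exp((1/2)L(ω + i√(2c)) + (1/2)L(ω - i√(2c)))`. -/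
noncomputable def sqBr (a : ℝ) (ω : ℂ) : ℂ :=
  Complex.exp ((1 / 2 : ℂ) * Lbr (ω + Complex.I * (Real.sqrt (2 * cOf a) : ℂ)) +
    (1 / 2 : ℂ) * Lbr (ω - Complex.I * (Real.sqrt (2 * cOf a) : ℂ)))

/-- `G(ω) = (ω - √(ω² + 2c))/√(2c)`. -/
noncomputable def Gbr (a : ℝ) (ω : ℂ) : ℂ :=
  (ω - sqBr a ω) / (Real.sqrt (2 * cOf a) : ℂ)

/-- The branch cuts `𝒞 = i·((-∞, -1/√(2c)] ∪ [-√(2c), √(2c)] ∪ [1/√(2c), ∞))`. -/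
def cuts (a : ℝ) : Set ℂ :=
  {z : ℂ | ∃ t : ℝ, z = Complex.I * (t : ℂ) ∧
    (t ≤ -(1 / Real.sqrt (2 * cOf a)) ∨
      (-Real.sqrt (2 * cOf a) ≤ t ∧ t ≤ Real.sqrt (2 * cOf a)) ∨
      1 / Real.sqrt (2 * cOf a) ≤ t)}

/-- The branch of the logarithm with argument in `(0, 2π]`: `L₃(z) = Log(-z) + iπ`. -/
noncomputable def L3 (z : ℂ) : ℂ := Complex.log (-z) + Complex.I * (Real.pi : ℂ)

/-- The saddle point function `g_ξ(ω) = L(ω) - ξ·L(G(ω)) + ξ·L₃(G(1/ω))`. -/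
noncomputable def gxi (a ξ : ℝ) (ω : ℂ) : ℂ :=
  Lbr ω - (ξ : ℂ) * Lbr (Gbr a ω) + (ξ : ℂ) * L3 (Gbr a ω⁻¹)

/-- The saddle point equation `1 + ξ₁·ω/√(ω²+2c) + ξ₂/(ω·√(ω⁻²+2c)) = 0`. -/
def saddleEq (a ξ₁ ξ₂ : ℝ) (ω : ℂ) : Prop :=
  1 + (ξ₁ : ℂ) * ω / sqBr a ω + (ξ₂ : ℂ) / (ω * sqBr a ω⁻¹) = 0

open Filter Topology

theorem cOf_pos {a : ℝ} (ha : 0 < a) : 0 < cOf a := by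
  unfold cOf; positivity

theorem two_mul_cOf_lt_one {a : ℝ} (ha : a < 1) : 2 * cOf a < 1 := by
  have h : 0 < 1 + a ^ 2 := by positivity
  unfold cOf
  rw [mul_div_assoc', div_lt_one h]
  nlinarith [mul_pos (sub_pos.2 ha) (sub_pos.2 ha)]

theorem exp_Lbr {z : ℂ} (hz : z ≠ 0) : Complex.exp (Lbr z) = z := by
  have h : Complex.exp (Complex.I * ((Real.pi : ℂ) / 2)) = Complex.I := by
    rw [mul_comm]; exact Complex.exp_pi_div_two_mul_I
  rw [Lbr, Complex.exp_add, Complex.exp_log (by simpa using hz), h]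
  linear_combination (-z) * Complex.I_mul_I

theorem hasDerivAt_Lbr {z : ℂ} (hz : -Complex.I * z ∈ Complex.slitPlane) :
    HasDerivAt Lbr z⁻¹ z := by
  have hz0 : z ≠ 0 := by
    rintro rfl
    simp at hz
  have h := (((hasDerivAt_id z).const_mul (-Complex.I)).clog hz).add_const
    (Complex.I * ((Real.pi : ℂ) / 2))
  refine h.congr_deriv ?_
  have := Complex.I_ne_zero
  simp only [id]
  field_simp

theorem neg_I_mul_mem_slitPlane {z : ℂ} (hz : 0 < z.im) :
    -Complex.I * z ∈ Complex.slitPlane := by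
  left
  simpa using hz

theorem im_add_I_mul (z : ℂ) (b : ℝ) : (z + Complex.I * b).im = z.im + b := by simp

theorem im_sub_I_mul (z : ℂ) (b : ℝ) : (z - Complex.I * b).im = z.im - b := by simp

theorem sqBr_ne_zero (a : ℝ) (z : ℂ) : sqBr a z ≠ 0 := Complex.exp_ne_zero _

theorem I_mul_sqrt_sq {a : ℝ} (ha : 0 < a) :
    (Complex.I * (Real.sqrt (2 * cOf a) : ℂ)) ^ 2 = -(2 * (cOf a : ℂ)) := by
  have h : Real.sqrt (2 * cOf a) ^ 2 = 2 * cOf a :=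
    Real.sq_sqrt (by have := cOf_pos ha; positivity)
  rw [mul_pow, Complex.I_sq, ← Complex.ofReal_pow, h]
  push_cast; ring

theorem sqBr_sq {a : ℝ} (ha : 0 < a) {z : ℂ} (hz : Real.sqrt (2 * cOf a) < z.im) :
    sqBr a z ^ 2 = z ^ 2 + 2 * (cOf a : ℂ) := by
  have hb := Real.sqrt_nonneg (2 * cOf a)
  have h1 : z + Complex.I * (Real.sqrt (2 * cOf a) : ℂ) ≠ 0 := fun h => by
    have := congrArg Complex.im h
    rw [im_add_I_mul, Complex.zero_im] at this
    linarith
  have h2 : z - Complex.I * (Real.sqrt (2 * cOf a) : ℂ) ≠ 0 := fun h => by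
    have := congrArg Complex.im h
    rw [im_sub_I_mul, Complex.zero_im] at this
    linarith
  rw [sqBr, ← Complex.exp_nat_mul]
  have h3 : ∀ x y : ℂ, ((2 : ℕ) : ℂ) * (1 / 2 * x + 1 / 2 * y) = x + y := fun x y => by
    push_cast; ring
  rw [h3, Complex.exp_add, exp_Lbr h1, exp_Lbr h2]
  linear_combination -(I_mul_sqrt_sq ha)

theorem hasDerivAt_sqBr {a : ℝ} (ha : 0 < a) {z : ℂ} (hz : Real.sqrt (2 * cOf a) < z.im) :
    HasDerivAt (sqBr a) (z / sqBr a z) z := by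
  have hb := Real.sqrt_nonneg (2 * cOf a)
  have hsq := sqBr_sq ha hz
  have hs := sqBr_ne_zero a z
  have hI := I_mul_sqrt_sq ha
  have hp : 0 < (z + Complex.I * (Real.sqrt (2 * cOf a) : ℂ)).im := by
    rw [im_add_I_mul]; linarith
  have hm : 0 < (z - Complex.I * (Real.sqrt (2 * cOf a) : ℂ)).im := by
    rw [im_sub_I_mul]; linarith
  have hp0 : z + Complex.I * (Real.sqrt (2 * cOf a) : ℂ) ≠ 0 := fun h => by
    rw [h] at hp; exact lt_irrefl _ hp
  have hm0 : z - Complex.I * (Real.sqrt (2 * cOf a) : ℂ) ≠ 0 := fun h => by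
    rw [h] at hm; exact lt_irrefl _ hm
  have h1 := (hasDerivAt_Lbr (neg_I_mul_mem_slitPlane hp)).comp_add_const
    z (Complex.I * (Real.sqrt (2 * cOf a) : ℂ))
  have h2 := (hasDerivAt_Lbr (neg_I_mul_mem_slitPlane hm)).comp_sub_const
    z (Complex.I * (Real.sqrt (2 * cOf a) : ℂ))
  have h := ((h1.const_mul (1 / 2 : ℂ)).add (h2.const_mul (1 / 2 : ℂ))).cexp
  refine h.congr_deriv ?_
  change sqBr a z * _ = _
  rw [eq_div_iff hs]
  generalize Complex.I * (Real.sqrt (2 * cOf a) : ℂ) = w at *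
  field_simp
  linear_combination (2 * z) * hsq + 2 * z * hI

/-- For `z` in the upper half plane, `Lbr (-z)` and `Lbr z` differ by `±πi`, the sign depending
only on the sign of the real part of `z`. -/
theorem Lbr_neg {z : ℂ} (hz : 0 < z.im) :
    Lbr (-z) = Lbr z + (if 0 ≤ z.re then Real.pi * Complex.I else -(Real.pi * Complex.I)) := by
  have hw : 0 < (-Complex.I * z).re := by simpa using hz
  have him : (-Complex.I * z).im = -z.re := by simp
  rw [Lbr, Lbr, mul_neg, Complex.log, Complex.log, norm_neg]
  split_ifs with h
  · rw [Complex.arg_neg_eq_arg_add_pi_iff.2]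
    · push_cast; ring
    · rw [him]
      rcases h.eq_or_lt with h | h
      · exact Or.inr ⟨by linarith, hw⟩
      · exact Or.inl (by linarith)
  · rw [Complex.arg_neg_eq_arg_sub_pi_of_im_pos (by linarith)]
    push_cast; ring

theorem sqBr_neg {a : ℝ} {z : ℂ} (hz : Real.sqrt (2 * cOf a) < z.im) :
    sqBr a (-z) = -sqBr a z := by
  have hb := Real.sqrt_nonneg (2 * cOf a)
  have hp : 0 < (z + Complex.I * (Real.sqrt (2 * cOf a) : ℂ)).im := by
    rw [im_add_I_mul]; linarith
  have hm : 0 < (z - Complex.I * (Real.sqrt (2 * cOf a) : ℂ)).im := by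
    rw [im_sub_I_mul]; linarith
  have hpr : (z + Complex.I * (Real.sqrt (2 * cOf a) : ℂ)).re = z.re := by simp
  have hmr : (z - Complex.I * (Real.sqrt (2 * cOf a) : ℂ)).re = z.re := by simp
  have e1 := Lbr_neg hp
  have e2 := Lbr_neg hm
  rw [hpr] at e1
  rw [hmr] at e2
  simp only [sqBr]
  generalize Complex.I * (Real.sqrt (2 * cOf a) : ℂ) = w at *
  rw [show -z + w = -(z - w) by ring, show -z - w = -(z + w) by ring, e1, e2]
  split_ifs
  · rw [show ∀ x y p : ℂ, 1 / 2 * (x + p) + 1 / 2 * (y + p) = (1 / 2 * y + 1 / 2 * x) + p from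
      fun x y p => by ring, Complex.exp_add, Complex.exp_pi_mul_I]
    ring
  · rw [show ∀ x y p : ℂ, 1 / 2 * (x + p) + 1 / 2 * (y + p) = (1 / 2 * y + 1 / 2 * x) + p from
      fun x y p => by ring, Complex.exp_add, Complex.exp_neg, Complex.exp_pi_mul_I]
    norm_num

theorem sqBr_I {a : ℝ} (ha0 : 0 < a) (ha1 : a < 1) :
    sqBr a Complex.I = Complex.I * (Real.sqrt (1 - 2 * cOf a) : ℂ) := by
  have hc := cOf_pos ha0
  have hc1 := two_mul_cOf_lt_one ha1
  have hb := Real.sqrt_nonneg (2 * cOf a)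
  have hb1 : Real.sqrt (2 * cOf a) < 1 := by
    rw [Real.sqrt_lt' one_pos]; linarith
  have key : ∀ x : ℝ, 0 < x →
      Lbr (Complex.I * x) = (Real.log x : ℂ) + Complex.I * ((Real.pi : ℂ) / 2) := fun x hx => by
    rw [Lbr, ← mul_assoc, neg_mul, Complex.I_mul_I, neg_neg, one_mul, Complex.ofReal_log hx.le]
  have h1 := key (1 + Real.sqrt (2 * cOf a)) (by linarith)
  have h2 := key (1 - Real.sqrt (2 * cOf a)) (by linarith)
  have h3 : Real.sqrt (1 - 2 * cOf a) = Real.exp (1 / 2 * Real.log (1 + Real.sqrt (2 * cOf a)) +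
      1 / 2 * Real.log (1 - Real.sqrt (2 * cOf a))) := by
    have e : 1 - 2 * cOf a = (1 + Real.sqrt (2 * cOf a)) * (1 - Real.sqrt (2 * cOf a)) := by
      linear_combination Real.sq_sqrt (show 0 ≤ 2 * cOf a by linarith)
    rw [← mul_add, ← Real.log_mul (by linarith) (by linarith), ← e, one_div,
      inv_mul_eq_div, ← Real.log_sqrt (by linarith), Real.exp_log (Real.sqrt_pos.2 (by linarith))]
  rw [sqBr, show Complex.I + Complex.I * (Real.sqrt (2 * cOf a) : ℂ) =
      Complex.I * ((1 + Real.sqrt (2 * cOf a) : ℝ) : ℂ) by push_cast; ring,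
    show Complex.I - Complex.I * (Real.sqrt (2 * cOf a) : ℂ) =
      Complex.I * ((1 - Real.sqrt (2 * cOf a) : ℝ) : ℂ) by push_cast; ring, h1, h2, h3,
    Complex.ofReal_exp]
  conv_rhs => rw [← Complex.exp_pi_div_two_mul_I, ← Complex.exp_add]
  congr 1
  push_cast
  ring

theorem hasDerivAt_Gbr {a : ℝ} (ha : 0 < a) {z : ℂ} (hz : Real.sqrt (2 * cOf a) < z.im) :
    HasDerivAt (Gbr a) (-(Gbr a z / sqBr a z)) z := by
  have hs := sqBr_ne_zero a z
  refine (((hasDerivAt_id z).sub (hasDerivAt_sqBr ha hz)).div_const _).congr_deriv ?_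
  rw [Gbr]
  field_simp
  ring

theorem Gbr_neg {a : ℝ} {z : ℂ} (hz : Real.sqrt (2 * cOf a) < z.im) :
    Gbr a (-z) = -Gbr a z := by
  rw [Gbr, Gbr, sqBr_neg hz]; ring

theorem Gbr_I {a : ℝ} (ha0 : 0 < a) (ha1 : a < 1) :
    ∃ x : ℝ, 0 < x ∧ Gbr a Complex.I = Complex.I * x := by
  have hc := cOf_pos ha0
  have hr : Real.sqrt (1 - 2 * cOf a) < 1 := by
    rw [Real.sqrt_lt' one_pos]; linarith
  refine ⟨(1 - Real.sqrt (1 - 2 * cOf a)) / Real.sqrt (2 * cOf a),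
    div_pos (by linarith) (Real.sqrt_pos.2 (by linarith)), ?_⟩
  rw [Gbr, sqBr_I ha0 ha1]
  push_cast
  ring

theorem hasDerivAt_neg_inv {z : ℂ} (hz : z ≠ 0) :
    HasDerivAt (fun w : ℂ => -w⁻¹) (z ^ 2)⁻¹ z := by
  simpa using (hasDerivAt_inv hz).fun_neg

theorem hasDerivAt_sqBr_neg_inv {a : ℝ} (ha : 0 < a) {z : ℂ} (hz : z ≠ 0)
    (hi : Real.sqrt (2 * cOf a) < (-z⁻¹).im) :
    HasDerivAt (fun w => sqBr a (-w⁻¹)) (-(1 / (z ^ 3 * sqBr a (-z⁻¹)))) z := by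
  refine ((hasDerivAt_sqBr ha hi).comp z (hasDerivAt_neg_inv hz)).congr_deriv ?_
  have hs := sqBr_ne_zero a (-z⁻¹)
  field_simp

theorem hasDerivAt_gxi {a : ℝ} (ξ : ℝ) (ha : 0 < a) {z : ℂ}
    (hz : Real.sqrt (2 * cOf a) < z.im) (hi : Real.sqrt (2 * cOf a) < (-z⁻¹).im)
    (hG : -Complex.I * Gbr a z ∈ Complex.slitPlane)
    (hG' : Gbr a (-z⁻¹) ∈ Complex.slitPlane) :
    HasDerivAt (gxi a ξ)
      (1 / z + ξ / sqBr a z - ξ / (z ^ 2 * sqBr a (-z⁻¹))) z := by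
  have hb := Real.sqrt_nonneg (2 * cOf a)
  have hz0 : z ≠ 0 := fun h => by
    simp only [h, Complex.zero_im] at hz
    linarith
  have hG0 : Gbr a z ≠ 0 := fun h => by simp [h] at hG
  have hG0' : Gbr a (-z⁻¹) ≠ 0 := fun h => by simp [h] at hG'
  have h1 := hasDerivAt_Lbr (neg_I_mul_mem_slitPlane (hb.trans_lt hz))
  have h2 := (hasDerivAt_Lbr hG).comp z (hasDerivAt_Gbr ha hz)
  have h3 := HasDerivAt.comp (h := fun w : ℂ => -w⁻¹) z (hasDerivAt_Gbr ha hi)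
    (hasDerivAt_neg_inv hz0)
  have he : (fun w => L3 (Gbr a w⁻¹)) =ᶠ[𝓝 z]
      fun w => Complex.log (Gbr a (-w⁻¹)) + Complex.I * (Real.pi : ℂ) := by
    have hc : ContinuousAt (fun w : ℂ => (-w⁻¹).im) z :=
      Complex.continuous_im.continuousAt.comp (hasDerivAt_neg_inv hz0).continuousAt
    filter_upwards [hc.eventually (lt_mem_nhds hi)] with w hw
    have := Gbr_neg hw
    rw [neg_neg] at this
    simp only [L3, this, neg_neg]
  have h4 := ((h3.clog hG').add_const (Complex.I * (Real.pi : ℂ))).congr_of_eventuallyEq he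
  refine ((h1.sub (h2.const_mul (ξ : ℂ))).add (h4.const_mul (ξ : ℂ))).congr_deriv ?_
  have hs := sqBr_ne_zero a z
  have hs' := sqBr_ne_zero a (-z⁻¹)
  simp only [Function.comp_apply]
  generalize Gbr a (-z⁻¹) = u at hG0' ⊢
  generalize sqBr a (-z⁻¹) = v at hs' ⊢
  field_simp
  ring

theorem iteratedDeriv_three_eq {f f₁ f₂ : ℂ → ℂ} {x v : ℂ}
    (h : ∀ᶠ z in 𝓝 x, HasDerivAt f (f₁ z) z) (h₁ : ∀ᶠ z in 𝓝 x, HasDerivAt f₁ (f₂ z) z)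
    (h₂ : HasDerivAt f₂ v x) : iteratedDeriv 3 f x = v := by
  have e : deriv f =ᶠ[𝓝 x] f₁ := h.mono fun _ hz => hz.deriv
  have e₁ : deriv f₁ =ᶠ[𝓝 x] f₂ := h₁.mono fun _ hz => hz.deriv
  rw [iteratedDeriv_succ, iteratedDeriv_succ, iteratedDeriv_one]
  rw [(e.deriv.trans e₁).deriv_eq, h₂.deriv]

/-- For `ξ = -(1/2)√(1-2c)`, the third complex derivative of the saddle
point function at `i` equals `g_ξ‴(i) = -4c(c+1)/(1-2c)²·i`. -/
theorem statement9 (a : ℝ) (ha0 : 0 < a) (ha1 : a < 1) :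
    iteratedDeriv 3 (gxi a (-(1 / 2) * Real.sqrt (1 - 2 * cOf a))) Complex.I =
      -(4 * (cOf a : ℂ) * ((cOf a : ℂ) + 1) / (1 - 2 * (cOf a : ℂ)) ^ 2) * Complex.I := by
  have hc := cOf_pos ha0
  have hc1 := two_mul_cOf_lt_one ha1
  have hb1 : Real.sqrt (2 * cOf a) < 1 := by
    rw [Real.sqrt_lt' one_pos]; linarith
  have hI : Real.sqrt (2 * cOf a) < Complex.I.im := by simpa using hb1
  have hII : -Complex.I⁻¹ = Complex.I := by simp
  have hI' : Real.sqrt (2 * cOf a) < (-Complex.I⁻¹).im := by rwa [hII]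
  have hI0 := Complex.I_ne_zero
  obtain ⟨x, hx, hGI⟩ := Gbr_I ha0 ha1
  have hinv := (hasDerivAt_neg_inv hI0).continuousAt
  have hGc : ContinuousAt (Gbr a) Complex.I := (hasDerivAt_Gbr ha0 hI).continuousAt
  have hGc' : ContinuousAt (fun w => Gbr a (-w⁻¹)) Complex.I :=
    ContinuousAt.comp (g := Gbr a) (f := fun w : ℂ => -w⁻¹) (by rwa [hII]) hinv
  have n1 : ∀ᶠ z in 𝓝 Complex.I, Real.sqrt (2 * cOf a) < z.im :=
    Complex.continuous_im.continuousAt.eventually (lt_mem_nhds hI)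
  have n2 : ∀ᶠ z in 𝓝 Complex.I, Real.sqrt (2 * cOf a) < (-z⁻¹).im :=
    (Complex.continuous_im.continuousAt.comp hinv).eventually (lt_mem_nhds hI')
  have n3 : ∀ᶠ z in 𝓝 Complex.I, -Complex.I * Gbr a z ∈ Complex.slitPlane := by
    refine (continuousAt_const.mul hGc).eventually (Complex.isOpen_slitPlane.mem_nhds ?_)
    exact neg_I_mul_mem_slitPlane (by simpa [hGI] using hx)
  have n4 : ∀ᶠ z in 𝓝 Complex.I, Gbr a (-z⁻¹) ∈ Complex.slitPlane := by
    refine hGc'.eventually (Complex.isOpen_slitPlane.mem_nhds ?_)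
    simp only [hII, hGI]
    right
    simpa using hx.ne'
  have n5 : ∀ᶠ z in 𝓝 Complex.I, z ≠ 0 := eventually_ne_nhds hI0
  generalize hξ : -(1 / 2) * Real.sqrt (1 - 2 * cOf a) = ξ
  refine iteratedDeriv_three_eq
    (f₁ := fun z => 1 / z + ξ / sqBr a z - ξ / (z ^ 2 * sqBr a (-z⁻¹)))
    (f₂ := fun z => -(1 / z ^ 2) - ξ * z / sqBr a z ^ 3 +
      (ξ * 2 / (z ^ 3 * sqBr a (-z⁻¹)) - ξ / (z ^ 5 * sqBr a (-z⁻¹) ^ 3))) ?_ ?_ ?_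
  · filter_upwards [n1, n2, n3, n4] with z h1 h2 h3 h4
    exact hasDerivAt_gxi ξ ha0 h1 h2 h3 h4
  · filter_upwards [n1, n2, n5] with z h1 h2 h5
    have hs := sqBr_ne_zero a z
    have hs' := sqBr_ne_zero a (-z⁻¹)
    have d := hasDerivAt_sqBr ha0 h1
    have d' := hasDerivAt_sqBr_neg_inv ha0 h5 h2
    refine ((((hasDerivAt_const z (1 : ℂ)).div (hasDerivAt_id z) h5).add
      ((hasDerivAt_const z (ξ : ℂ)).div d hs)).sub
      ((hasDerivAt_const z (ξ : ℂ)).div ((hasDerivAt_pow 2 z).mul d')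
        (mul_ne_zero (pow_ne_zero _ h5) hs'))).congr_deriv ?_
    simp only [id, Pi.mul_apply]
    field_simp
    ring
  · have hs := sqBr_ne_zero a Complex.I
    have hs' := sqBr_ne_zero a (-Complex.I⁻¹)
    have d := hasDerivAt_sqBr ha0 hI
    have d' := hasDerivAt_sqBr_neg_inv ha0 hI0 hI'
    refine ((((hasDerivAt_const _ (1 : ℂ)).div (hasDerivAt_pow 2 Complex.I)
      (pow_ne_zero _ hI0)).neg.sub
      (((hasDerivAt_id Complex.I).const_mul (ξ : ℂ)).div (d.pow 3) (pow_ne_zero _ hs))).add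
      (((hasDerivAt_const _ ((ξ : ℂ) * 2)).div ((hasDerivAt_pow 3 Complex.I).mul d')
        (mul_ne_zero (pow_ne_zero _ hI0) hs')).sub
      ((hasDerivAt_const _ (ξ : ℂ)).div ((hasDerivAt_pow 5 Complex.I).mul (d'.pow 3))
        (mul_ne_zero (pow_ne_zero _ hI0) (pow_ne_zero _ hs'))))).congr_deriv ?_
    simp only [id, Pi.mul_apply, Pi.pow_apply, hII, sqBr_I ha0 ha1, ← hξ, Complex.ofReal_mul]
    have hr0 : (Real.sqrt (1 - 2 * cOf a) : ℂ) ≠ 0 := by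
      exact_mod_cast (Real.sqrt_pos.2 (by linarith)).ne'
    have hr : (cOf a : ℂ) = (1 - (Real.sqrt (1 - 2 * cOf a) : ℂ) ^ 2) / 2 := by
      rw [← Complex.ofReal_pow, Real.sq_sqrt (by linarith)]
      push_cast; ring
    generalize (Real.sqrt (1 - 2 * cOf a) : ℂ) = r at *
    rw [hr, show 1 - 2 * ((1 - r ^ 2) / 2) = r ^ 2 by ring]
    push_cast
    field_simp
    rw [show Complex.I ^ 10 = (Complex.I ^ 2) ^ 5 by ring,
      show Complex.I ^ 6 = (Complex.I ^ 2) ^ 3 by ring, Complex.I_pow_four, Complex.I_sq]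
    ring
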